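/- Let Γ_S ⊆ S¹ be Borel measurable, let Γ_Δ ⊆ Γ_S be Borel measurable, let λ ∈ ℝ, and let x_S, y ∈ D with x_S ≠ y. Suppose R_M, R_y : ℝ² → ℝ are continuously differentiable on an open neighborhood of the closed unit disk and harmonic on D. Define S_M(z) = (1/(2π))·log‖x_S − z‖ + R_M(z) and S_y(z) = (1/(2π))·log‖y − z‖ + R_y(z). Assume S_M satisfies the perturbed boundary conditions p · ∇S_M(p) = λ · S_M(p) for p ∈ Γ_S \ Γ_Δ and p · ∇S_M(p) = 0 for p ∈ (S¹ \ Γ_S) ∪ Γ_Δ, while S_y satisfies the unperturbed conditions p · ∇S_y(p) = λ · S_y(p) for p ∈ Γ_S and p · ∇S_y(p) = 0 for p ∈ S¹ \ Γ_S. Then S_M(y) − S_y(x_S) = λ · ∫_{Γ_Δ} S_y(p) · S_M(p) dσ(p). -/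

import Mathlib

open MeasureTheory Metric

/-- The Laplacian `∂²u/∂x₁² + ∂²u/∂x₂²` of `u : ℝ² → ℝ` at a point `p`. -/
noncomputable def laplacian2 (u : EuclideanSpace ℝ (Fin 2) → ℝ)
    (p : EuclideanSpace ℝ (Fin 2)) : ℝ :=
  ∑ i : Fin 2,
    fderiv ℝ (fun x => fderiv ℝ u x (EuclideanSpace.single i (1 : ℝ))) p
      (EuclideanSpace.single i (1 : ℝ))

/-- `u` is harmonic on an open set `U ⊆ ℝ²`: it is twice continuously differentiable
on `U` and its Laplacian vanishes at every point of `U`. -/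
def IsHarmonicOn (u : EuclideanSpace ℝ (Fin 2) → ℝ)
    (U : Set (EuclideanSpace ℝ (Fin 2))) : Prop :=
  ContDiffOn ℝ 2 u U ∧ ∀ p ∈ U, laplacian2 u p = 0

section

open InnerProductSpace
open scoped ENNReal NNReal

/-- The real derivative of the real part of a holomorphic function. -/
lemma fderiv_eq_re_deriv_mul {f : ℂ → ℂ} {u : ℂ → ℝ} {U : Set ℂ} (hU : IsOpen U)
    (hf : AnalyticOnNhd ℂ f U) (hfu : U.EqOn (fun z ↦ (f z).re) u) {z : ℂ} (hz : z ∈ U) (w : ℂ) :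
    fderiv ℝ u z w = (deriv f z * w).re := by
  have hd := ((hf z hz).differentiableAt.hasDerivAt.hasFDerivAt.restrictScalars ℝ)
  have hre := (Complex.reCLM.hasFDerivAt (x := f z)).comp z hd
  have heq : u =ᶠ[nhds z] fun z ↦ (f z).re :=
    Filter.eventually_of_mem (hU.mem_nhds hz) fun x hx ↦ (hfu hx).symm
  rw [(hre.congr_of_eventuallyEq heq).fderiv]
  simp [mul_comm]

/-- The integrand `u ∂ᵣv - v ∂ᵣu` of Green's second identity on circles centered at zero, scaled
by the radius. -/
noncomputable def radialWronskian (u v : ℂ → ℝ) (z : ℂ) : ℝ :=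
  u z * fderiv ℝ v z z - v z * fderiv ℝ u z z

lemma circleAverage_radialWronskian_of_lt {u v : ℂ → ℝ} (hu : HarmonicOnNhd u (ball 0 1))
    (hv : HarmonicOnNhd v (ball 0 1)) {r : ℝ} (hr0 : 0 ≤ r) (hr : r < 1) :
    Real.circleAverage (radialWronskian u v) 0 r = 0 := by
  obtain ⟨f, hf, hfu⟩ := hu.exists_analyticOnNhd_ball_re_eq
  obtain ⟨g, hg, hgv⟩ := hv.exists_analyticOnNhd_ball_re_eq
  have hmem (θ : ℝ) : circleMap 0 r θ ∈ ball (0 : ℂ) 1 := by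
    simpa [abs_of_nonneg hr0] using hr
  have hcomp {f : ℂ → ℂ} (hf : AnalyticOnNhd ℂ f (ball 0 1)) (θ : ℝ) :
      HasDerivAt (fun θ ↦ f (circleMap 0 r θ))
        (deriv f (circleMap 0 r θ) * (circleMap 0 r θ * Complex.I)) θ := by
    simpa [Function.comp_def] using
      (hf _ (hmem θ)).differentiableAt.hasDerivAt.comp θ (hasDerivAt_circleMap 0 r θ)
  have hderiv (θ : ℝ) : HasDerivAt (fun θ ↦ (f (circleMap 0 r θ)).im * (g (circleMap 0 r θ)).re)
      ((deriv f (circleMap 0 r θ) * (circleMap 0 r θ * Complex.I)).im * (g (circleMap 0 r θ)).re +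
      (f (circleMap 0 r θ)).im *
        (deriv g (circleMap 0 r θ) * (circleMap 0 r θ * Complex.I)).re) θ :=
    ((Complex.imCLM.hasFDerivAt.comp_hasDerivAt θ (hcomp hf θ))).mul
      ((Complex.reCLM.hasFDerivAt.comp_hasDerivAt θ (hcomp hg θ)))
  have hcont {f : ℂ → ℂ} (hf : AnalyticOnNhd ℂ f (ball 0 1)) :
      Continuous fun θ ↦ f (circleMap 0 r θ) :=
    hf.continuousOn.comp_continuous (by fun_prop) hmem
  have hcont' {f : ℂ → ℂ} (hf : AnalyticOnNhd ℂ f (ball 0 1)) :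
      Continuous fun θ ↦ deriv f (circleMap 0 r θ) * (circleMap 0 r θ * Complex.I) :=
    (hcont hf.deriv).mul (by fun_prop)
  have hc1 := (hcont hf).mul (hcont' hg)
  have hc2 := ((Complex.continuous_im.comp (hcont' hf)).mul
    (Complex.continuous_re.comp (hcont hg))).add ((Complex.continuous_im.comp (hcont hf)).mul
    (Complex.continuous_re.comp (hcont' hg)))
  have hW : ∀ θ, radialWronskian u v (circleMap 0 r θ) =
      (f (circleMap 0 r θ) * (deriv g (circleMap 0 r θ) * (circleMap 0 r θ * Complex.I))).im -
      ((deriv f (circleMap 0 r θ) * (circleMap 0 r θ * Complex.I)).im * (g (circleMap 0 r θ)).re +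
      (f (circleMap 0 r θ)).im *
        (deriv g (circleMap 0 r θ) * (circleMap 0 r θ * Complex.I)).re) := by
    intro θ
    rw [radialWronskian, fderiv_eq_re_deriv_mul isOpen_ball hf hfu (hmem θ),
      fderiv_eq_re_deriv_mul isOpen_ball hg hgv (hmem θ), ← hfu (hmem θ), ← hgv (hmem θ)]
    simp only [Complex.mul_re, Complex.mul_im, Complex.I_re, Complex.I_im]
    ring
  have hcauchy : ∮ z in C(0, r), f z * deriv g z = 0 := by
    refine Complex.circleIntegral_eq_zero_of_differentiable_on_off_countable hr0
      Set.countable_empty ?_ fun z hz ↦ ?_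
    · exact (hf.continuousOn.mul hg.deriv.continuousOn).mono (closedBall_subset_ball hr)
    · have hz' := (ball_subset_ball hr.le) hz.1
      exact (hf z hz').differentiableAt.mul (hg.deriv z hz').differentiableAt
  have hcauchy' : ∫ θ in (0 : ℝ)..2 * Real.pi,
      (f (circleMap 0 r θ) * (deriv g (circleMap 0 r θ) * (circleMap 0 r θ * Complex.I))).im
      = 0 := by
    have h := Complex.imCLM.intervalIntegral_comp_comm
      (μ := volume) (a := 0) (b := 2 * Real.pi) (hc1.intervalIntegrable _ _)
    refine h.trans ?_
    rw [circleIntegral] at hcauchy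
    refine (congrArg Complex.im (intervalIntegral.integral_congr fun θ _ ↦ ?_)).trans
      (congrArg Complex.im hcauchy)
    simp only [deriv_circleMap, smul_eq_mul, Pi.mul_apply]
    ring
  rw [Real.circleAverage]
  simp_rw [hW]
  rw [intervalIntegral.integral_sub, hcauchy', intervalIntegral.integral_eq_sub_of_hasDerivAt
    (fun θ _ ↦ hderiv θ)]
  · simp [circleMap]
  · exact hc2.intervalIntegrable _ _
  · exact (Complex.continuous_im.comp hc1).intervalIntegrable _ _
  · exact hc2.intervalIntegrable _ _

lemma continuousOn_radialWronskian {u v : ℂ → ℝ} {U : Set ℂ} (hU : IsOpen U)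
    (hu : ContDiffOn ℝ 1 u U) (hv : ContDiffOn ℝ 1 v U) :
    ContinuousOn (radialWronskian u v) U :=
  (hu.continuousOn.mul ((hv.continuousOn_fderiv_of_isOpen hU le_rfl).clm_apply
    continuousOn_id)).sub (hv.continuousOn.mul
    ((hu.continuousOn_fderiv_of_isOpen hU le_rfl).clm_apply continuousOn_id))

/-- Green's second identity on the unit disk for functions harmonic in the disk and continuously
differentiable up to the boundary. -/
lemma circleAverage_radialWronskian {u v : ℂ → ℝ} (hu : HarmonicOnNhd u (ball 0 1))
    (hv : HarmonicOnNhd v (ball 0 1)) {U : Set ℂ} (hU : IsOpen U) (hUb : closedBall 0 1 ⊆ U)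
    (hu1 : ContDiffOn ℝ 1 u U) (hv1 : ContDiffOn ℝ 1 v U) :
    Real.circleAverage (radialWronskian u v) 0 1 = 0 := by
  refine Real.ContinuousOn.eq_of_eqOn_Ioo (r := 0) ?_ zero_lt_one
    fun r hr ↦ circleAverage_radialWronskian_of_lt hu hv hr.1.le hr.2
  refine Real.ContinuousOn.circleAverage ?_ fun r hr ↦ hr.1.le
  exact (continuousOn_radialWronskian hU hu1 hv1).mono fun z hz ↦ hUb (by simpa using hz.2)

lemma norm_circleMap_zero_one_sub (s t : ℝ) :
    ‖circleMap 0 1 s - circleMap 0 1 t‖ = 2 * |Real.sin ((s - t) / 2)| := by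
  have h : circleMap 0 1 s - circleMap 0 1 t =
      circleMap 0 1 t * (Complex.exp (Complex.I * ((s - t : ℝ) : ℂ)) - 1) := by
    simp only [circleMap, zero_add, Complex.ofReal_one, one_mul, mul_sub, ← Complex.exp_add,
      mul_one]
    congr 2
    push_cast
    ring
  rw [h, norm_mul, Complex.norm_exp_I_mul_ofReal_sub_one]
  simp

/-- Chords of short arcs of the unit circle are nearly as long as the arcs. -/
lemma exists_forall_abs_sub_le_mul_norm_circleMap_sub {K : ℝ} (hK : 1 < K) :
    ∃ δ > 0, ∀ s t : ℝ, |s - t| ≤ δ → |s - t| ≤ K * ‖circleMap 0 1 s - circleMap 0 1 t‖ := by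
  have hK' : 0 < 1 - 1 / K := by
    rw [sub_pos, div_lt_one (by linarith)]
    exact hK
  have hK0 : 0 < K := by linarith
  refine ⟨√(1 - 1 / K), Real.sqrt_pos.2 hK', fun s t hst ↦ ?_⟩
  rw [norm_circleMap_zero_one_sub]
  rcases (abs_nonneg (s - t)).eq_or_lt with h0 | h0
  · rw [← h0]
    positivity
  have hsq : |s - t| ^ 2 ≤ 1 - 1 / K := (Real.le_sqrt h0.le hK'.le).1 hst
  have hsin := Real.sin_gt_sub_cube (half_pos h0)
  have habs : Real.sin (|s - t| / 2) ≤ |Real.sin ((s - t) / 2)| := by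
    rcases abs_cases (s - t) with ⟨h, -⟩ | ⟨h, -⟩
    · rw [h]
      exact le_abs_self _
    · rw [h, neg_div, Real.sin_neg]
      exact neg_le_abs _
  calc |s - t| = K * (|s - t| * (1 / K)) := by field_simp
    _ ≤ K * (2 * |Real.sin ((s - t) / 2)|) := by
      refine mul_le_mul_of_nonneg_left ?_ hK0.le
      nlinarith [mul_le_mul_of_nonneg_left hsq h0.le]

/-- The arc length of a short piece of the unit circle is nearly bounded by its diameter. -/
lemma exists_forall_volume_preimage_circleMap_le {K : ℝ≥0} (hK : 1 < K) :
    ∃ ε : ℝ≥0∞, 0 < ε ∧ ∀ s : Set ℂ, MeasurableSet s → ediam s ≤ ε →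
      volume (circleMap 0 1 ⁻¹' s ∩ Set.Ioc 0 (2 * Real.pi)) ≤ K * ediam s := by
  obtain ⟨δ, hδ, h⟩ := exists_forall_abs_sub_le_mul_norm_circleMap_sub (K := K) (mod_cast hK)
  refine ⟨ENNReal.ofReal (δ / Real.pi), by simp [hδ, Real.pi_pos], fun s hs hsε ↦ ?_⟩
  rcases (circleMap 0 1 ⁻¹' s).eq_empty_or_nonempty with he | ⟨t₀, ht₀⟩
  · simp [he]
  have hper : volume (circleMap 0 1 ⁻¹' s ∩ Set.Ioc 0 (2 * Real.pi)) =
      volume (circleMap 0 1 ⁻¹' s ∩ Set.Ioc (t₀ - Real.pi) (t₀ - Real.pi + 2 * Real.pi)) := by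
    have : VAddInvariantMeasure (AddSubgroup.zmultiples (2 * Real.pi)) ℝ volume :=
      ⟨fun c s _ => measure_preimage_add _ _ _⟩
    have h1 := isAddFundamentalDomain_Ioc Real.two_pi_pos 0
    rw [zero_add] at h1
    refine h1.measure_set_eq (isAddFundamentalDomain_Ioc Real.two_pi_pos _)
      (hs.preimage (continuous_circleMap 0 1).measurable) fun g ↦ ?_
    ext t
    have := (periodic_circleMap 0 1).map_vadd_zmultiples g t
    simp only [Set.mem_preimage, this]
  have hdist : ∀ t ∈ circleMap 0 1 ⁻¹' s ∩
      Set.Ioc (t₀ - Real.pi) (t₀ - Real.pi + 2 * Real.pi), |t - t₀| ≤ δ / 2 := by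
    rintro t ⟨hts, ht1, ht2⟩
    have hd : ‖circleMap 0 1 t - circleMap 0 1 t₀‖ ≤ δ / Real.pi := by
      rw [← dist_eq_norm, dist_edist]
      exact ENNReal.toReal_le_of_le_ofReal (by positivity)
        ((edist_le_ediam_of_mem (s := s) hts ht₀).trans hsε)
    rw [norm_circleMap_zero_one_sub] at hd
    have habs : |t - t₀| ≤ Real.pi := abs_le.2 ⟨by linarith, by linarith⟩
    have habs' : |(t - t₀) / 2| = |t - t₀| / 2 := by rw [abs_div, abs_two]
    have hsin := Real.mul_abs_le_abs_sin (x := (t - t₀) / 2) (by rw [habs']; linarith)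
    rw [habs'] at hsin
    rw [le_div_iff₀ Real.pi_pos] at hd
    have : 2 / Real.pi * (|t - t₀| / 2) * Real.pi = |t - t₀| := by field_simp
    nlinarith [mul_le_mul_of_nonneg_right hsin Real.pi_pos.le]
  rw [hper]
  refine (Real.volume_le_diam _).trans (ediam_le fun x hx y hy ↦ ?_)
  have hxy : |x - y| ≤ δ := by
    have := abs_sub_le x t₀ y
    have h1 := hdist x hx
    have h2 := hdist y hy
    rw [abs_sub_comm] at h2
    linarith
  calc edist x y = ENNReal.ofReal |x - y| := by rw [edist_dist, Real.dist_eq]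
    _ ≤ ENNReal.ofReal (K * ‖circleMap 0 1 x - circleMap 0 1 y‖) :=
      ENNReal.ofReal_le_ofReal (h x y hxy)
    _ = K * edist (circleMap 0 1 x) (circleMap 0 1 y) := by
      rw [ENNReal.ofReal_mul K.coe_nonneg, ENNReal.ofReal_coe_nnreal, edist_dist, dist_eq_norm]
    _ ≤ K * ediam s := by
      gcongr
      exact edist_le_ediam_of_mem (s := s) hx.1 hy.1

/-- Arc length on the unit circle is the one-dimensional Hausdorff measure. -/
lemma map_circleMap_eq_hausdorffMeasure_restrict :
    Measure.map (circleMap 0 1) (volume.restrict (Set.Ioc 0 (2 * Real.pi))) =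
      (μH[1] : Measure ℂ).restrict (sphere 0 1) := by
  have hm : Measurable (circleMap 0 1) := (continuous_circleMap 0 1).measurable
  have hsurj : circleMap 0 1 '' Set.Ioc 0 (2 * Real.pi) = sphere 0 1 := by
    simp
  set ν := Measure.map (circleMap 0 1) (volume.restrict (Set.Ioc 0 (2 * Real.pi))) with hν
  have hν_apply {s : Set ℂ} (hs : MeasurableSet s) :
      ν s = volume (circleMap 0 1 ⁻¹' s ∩ Set.Ioc 0 (2 * Real.pi)) := by
    rw [hν, Measure.map_apply hm hs, Measure.restrict_apply (hm hs)]
  have hle : ν ≤ μH[1] := by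
    have hK {K : ℝ≥0} (hK : 1 < K) : K⁻¹ • ν ≤ μH[1] := by
      obtain ⟨ε, hε, h⟩ := exists_forall_volume_preimage_circleMap_le hK
      refine Measure.le_hausdorffMeasure 1 _ ε hε fun s hs ↦ ?_
      have := h (closure s) isClosed_closure.measurableSet (by rwa [ediam_closure])
      rw [← hν_apply isClosed_closure.measurableSet, ediam_closure] at this
      have hK0 : K ≠ 0 := by positivity
      calc (K⁻¹ • ν) s ≤ K⁻¹ * (K * ediam s) := by
            rw [Measure.smul_apply, ENNReal.smul_def, smul_eq_mul]
            gcongr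
            exact (measure_mono subset_closure).trans this
        _ = ediam s ^ (1 : ℝ) := by
            rw [← mul_assoc, ← ENNReal.coe_mul, inv_mul_cancel₀ hK0]
            simp
    intro s
    have hlim : Filter.Tendsto (fun K : ℝ≥0 ↦ (K : ℝ≥0∞) * μH[1] s) (nhdsWithin 1 (Set.Ioi 1))
        (nhds (μH[1] s)) := by
      have h := ENNReal.Tendsto.mul_const (b := μH[1] s)
        (ENNReal.tendsto_coe.2 (Filter.tendsto_id (x := nhds (1 : ℝ≥0)))) (by simp)
      simpa using h.mono_left nhdsWithin_le_nhds
    refine ge_of_tendsto hlim (Filter.eventually_of_mem self_mem_nhdsWithin fun K hK1 ↦ ?_)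
    have hK0 : K ≠ 0 := (zero_lt_one.trans hK1).ne'
    have h := hK hK1 s
    rw [Measure.smul_apply, ENNReal.smul_def, smul_eq_mul] at h
    calc ν s = K * ((K⁻¹ : ℝ≥0) * ν s) := by
          rw [← mul_assoc, ← ENNReal.coe_mul, mul_inv_cancel₀ hK0, ENNReal.coe_one, one_mul]
      _ ≤ K * μH[1] s := by gcongr
  refine le_antisymm ?_ ?_
  · have hres : ν.restrict (sphere 0 1) = ν := by
      refine Measure.restrict_eq_self_of_ae_mem ?_
      rw [hν, ae_map_iff (p := fun x ↦ x ∈ sphere (0 : ℂ) 1) hm.aemeasurable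
        isClosed_sphere.measurableSet]
      simp
    rw [← hres]
    exact Measure.restrict_mono le_rfl hle
  · refine Measure.le_intro fun s hs _ ↦ ?_
    have himg : s ∩ sphere 0 1 =
        circleMap 0 1 '' (circleMap 0 1 ⁻¹' s ∩ Set.Ioc 0 (2 * Real.pi)) := by
      rw [Set.inter_comm _ (Set.Ioc _ _), Set.image_inter_preimage, hsurj, Set.inter_comm]
    rw [Measure.restrict_apply hs, hν_apply hs, himg, ← hausdorffMeasure_real]
    simpa using (lipschitzWith_circleMap 0 1).hausdorffMeasure_image_le zero_le_one _

/-- A harmonic function on the plane, read in the complex coordinate, is harmonic. -/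
lemma IsHarmonicOn.harmonicOnNhd_comp {u : EuclideanSpace ℝ (Fin 2) → ℝ}
    {U : Set (EuclideanSpace ℝ (Fin 2))} (hU : IsOpen U) (hu : IsHarmonicOn u U) :
    HarmonicOnNhd (u ∘ Complex.orthonormalBasisOneI.repr)
      (Complex.orthonormalBasisOneI.repr ⁻¹' U) := by
  set e := Complex.orthonormalBasisOneI.repr with he
  have hev : ∀ i, e (Complex.orthonormalBasisOneI i) = EuclideanSpace.single i (1 : ℝ) := fun i ↦
    Complex.orthonormalBasisOneI.repr_self i
  have hC (q : ℂ) (hq : q ∈ e ⁻¹' U) : ContDiffAt ℝ 2 u (e q) :=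
    hu.1.contDiffAt (hU.mem_nhds hq)
  intro p hp
  refine ⟨(hC p hp).comp p e.contDiff.contDiffAt, ?_⟩
  filter_upwards [(hU.preimage e.continuous).mem_nhds hp] with q hq
  rw [laplacian_eq_iteratedFDeriv_orthonormalBasis _ Complex.orthonormalBasisOneI,
    Pi.zero_apply, ← hu.2 (e q) hq, laplacian2]
  have hd : DifferentiableAt ℝ (fderiv ℝ u) (e q) :=
    ((hC q hq).fderiv_right (m := 1) (by norm_num)).differentiableAt (by norm_num)
  refine Finset.sum_congr rfl fun i _ ↦ ?_
  have h1 : fderiv ℝ (u ∘ e) =ᶠ[nhds q] fun x ↦ (fderiv ℝ u (e x)).comp (e : ℂ →L[ℝ] _) := by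
    filter_upwards [(hU.preimage e.continuous).mem_nhds hq] with x hx
    exact e.toContinuousLinearEquiv.comp_right_fderiv
  rw [iteratedFDeriv_two_apply, h1.fderiv_eq]
  have h2 := (hd.hasFDerivAt.comp q e.toContinuousLinearEquiv.hasFDerivAt).clm_comp
    (hasFDerivAt_const (e : ℂ →L[ℝ] _) q)
  have h3 := hd.hasFDerivAt.clm_apply
    (hasFDerivAt_const (EuclideanSpace.single i (1 : ℝ) : EuclideanSpace ℝ (Fin 2)) (e q))
  erw [h2.fderiv]
  rw [h3.fderiv]
  simp [-Complex.coe_orthonormalBasisOneI, hev]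

/-- The real derivative of `log ‖f‖` for `f` complex differentiable. -/
lemma fderiv_log_norm {f : ℂ → ℂ} {f' z : ℂ} (hf : HasDerivAt f f' z) (h0 : f z ≠ 0) (w : ℂ) :
    fderiv ℝ (fun z ↦ Real.log ‖f z‖) z w = (f' * w / f z).re := by
  have h1 := ((hf.hasFDerivAt.restrictScalars ℝ).norm_sq).log (by positivity)
  have h2 : (fun z ↦ Real.log ‖f z‖) = fun z ↦ (1 / 2 : ℝ) * Real.log (‖f z‖ ^ 2) := by
    ext; simp
  rw [h2, (h1.const_mul _).fderiv]
  simp [Complex.div_re, Complex.normSq_eq_norm_sq]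
  ring

lemma setIntegral_hausdorffMeasure_eq_intervalIntegral {F : ℂ → ℝ}
    (hF : ContinuousOn F (sphere 0 1)) {A : Set ℂ} (hA : MeasurableSet A)
    (hAs : A ⊆ sphere 0 1) :
    ∫ z in A, F z ∂(μH[1] : Measure ℂ) =
      ∫ θ in (0 : ℝ)..2 * Real.pi, A.indicator F (circleMap 0 1 θ) := by
  have hmeas : AEStronglyMeasurable (A.indicator F)
      (Measure.map (circleMap 0 1) (volume.restrict (Set.Ioc 0 (2 * Real.pi)))) := by
    rw [map_circleMap_eq_hausdorffMeasure_restrict]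
    exact (hF.aestronglyMeasurable isClosed_sphere.measurableSet).indicator hA
  rw [intervalIntegral.integral_of_le Real.two_pi_pos.le,
    ← integral_map (continuous_circleMap 0 1).aemeasurable hmeas,
    map_circleMap_eq_hausdorffMeasure_restrict, integral_indicator hA,
    Measure.restrict_restrict hA, Set.inter_eq_left.2 hAs]

/-- The regular part of the reflected logarithmic potential with pole `a`. -/
noncomputable def reflectedLog (a z : ℂ) : ℝ :=
  1 / (2 * Real.pi) * Real.log ‖1 - (starRingEnd ℂ) a * z‖

lemma one_sub_conj_mul_ne_zero {a z : ℂ} (ha : a ∈ ball 0 1) (hz : z ∈ closedBall 0 1) :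
    1 - (starRingEnd ℂ) a * z ≠ 0 := by
  intro h
  have h1 := congrArg norm (sub_eq_zero.1 h)
  rw [norm_one, norm_mul, RCLike.norm_conj] at h1
  rw [mem_ball_zero_iff] at ha
  rw [mem_closedBall_zero_iff] at hz
  nlinarith [norm_nonneg a, norm_nonneg z]

lemma reflectedLog_comm (a b : ℂ) : reflectedLog a b = reflectedLog b a := by
  rw [reflectedLog, reflectedLog, ← RCLike.norm_conj (1 - (starRingEnd ℂ) a * b)]
  simp [mul_comm]

lemma harmonicOnNhd_reflectedLog (a : ℂ) :
    HarmonicOnNhd (reflectedLog a) {z | 1 - (starRingEnd ℂ) a * z ≠ 0} := fun z hz ↦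
  ((show AnalyticAt ℂ (fun z ↦ 1 - (starRingEnd ℂ) a * z) z by fun_prop).harmonicAt_log_norm
    hz).const_smul

lemma contDiffOn_reflectedLog (a : ℂ) :
    ContDiffOn ℝ 1 (reflectedLog a) {z | 1 - (starRingEnd ℂ) a * z ≠ 0} :=
  (harmonicOnNhd_reflectedLog a).contDiffOn.of_le (by norm_num)

lemma norm_sub_eq_norm_one_sub_conj_mul (a : ℂ) {z : ℂ} (hz : z ∈ sphere 0 1) :
    ‖a - z‖ = ‖1 - (starRingEnd ℂ) a * z‖ := by
  rw [mem_sphere_zero_iff_norm] at hz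
  have h1 : (starRingEnd ℂ) z * z = 1 := by
    rw [mul_comm, Complex.mul_conj, Complex.normSq_eq_norm_sq, hz]
    simp
  have h2 : 1 - (starRingEnd ℂ) a * z = (starRingEnd ℂ) (z - a) * z := by
    rw [map_sub, sub_mul, h1]
  rw [h2, norm_mul, RCLike.norm_conj, hz, mul_one, norm_sub_rev]

/-- The normal derivatives of the logarithmic potential and of its reflection differ by the
Poisson kernel on the unit circle. -/
lemma fderiv_log_norm_sub_apply_self {a z : ℂ} (ha : a ∈ ball 0 1) (hz : z ∈ sphere 0 1) :
    fderiv ℝ (fun z ↦ 1 / (2 * Real.pi) * Real.log ‖a - z‖) z z =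
      fderiv ℝ (reflectedLog a) z z + 1 / (2 * Real.pi) * poissonKernel 0 a z := by
  have hz1 := mem_sphere_zero_iff_norm.1 hz
  have hne : 1 - (starRingEnd ℂ) a * z ≠ 0 :=
    one_sub_conj_mul_ne_zero ha (sphere_subset_closedBall hz)
  have hne' : a - z ≠ 0 := by
    rw [← norm_ne_zero_iff, norm_sub_eq_norm_one_sub_conj_mul a hz]
    exact norm_ne_zero_iff.2 hne
  have hd1 : DifferentiableAt ℝ (fun z ↦ Real.log ‖a - z‖) z :=
    ((show AnalyticAt ℂ (fun z ↦ a - z) z by fun_prop).harmonicAt_log_norm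
      hne').1.differentiableAt (by norm_num)
  have hd2 : DifferentiableAt ℝ (fun z ↦ Real.log ‖1 - (starRingEnd ℂ) a * z‖) z :=
    ((show AnalyticAt ℂ (fun z ↦ 1 - (starRingEnd ℂ) a * z) z by fun_prop).harmonicAt_log_norm
      hne).1.differentiableAt (by norm_num)
  have hf1 : HasDerivAt (fun z ↦ a - z) (-1) z := by
    simpa using (hasDerivAt_id z).const_sub a
  have hf2 : HasDerivAt (fun z ↦ 1 - (starRingEnd ℂ) a * z) (-(starRingEnd ℂ) a) z := by
    simpa using ((hasDerivAt_id z).const_mul ((starRingEnd ℂ) a)).const_sub 1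
  unfold reflectedLog
  rw [fderiv_const_mul hd1, fderiv_const_mul hd2, FunLike.coe_smul, FunLike.coe_smul,
    Pi.smul_apply, Pi.smul_apply, fderiv_log_norm hf1 hne', fderiv_log_norm hf2 hne,
    smul_eq_mul, smul_eq_mul, ← mul_add]
  congr 1
  have hzz : (starRingEnd ℂ) z * z = 1 := by
    rw [mul_comm, Complex.mul_conj, Complex.normSq_eq_norm_sq, hz1]
    simp
  have hcne : (starRingEnd ℂ) (z - a) ≠ 0 := by
    rw [map_ne_zero, ← neg_sub, neg_ne_zero]
    exact hne'
  have hz0 : z ≠ 0 := by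
    rintro rfl
    simp at hz1
  have hconj : (-(starRingEnd ℂ) a * z / (1 - (starRingEnd ℂ) a * z)).re = (a / (a - z)).re := by
    rw [← Complex.conj_re (a / (a - z))]
    congr 1
    have h2 : 1 - (starRingEnd ℂ) a * z = (starRingEnd ℂ) (z - a) * z := by
      rw [map_sub, sub_mul, hzz]
    rw [h2, mul_div_mul_right _ _ hz0, map_div₀, ← neg_sub z a, map_neg, div_neg, neg_div]
  rw [hconj, poissonKernel_eq_re_herglotzRieszKernel, Function.comp_apply,
    herglotzRieszKernel_def, ← Complex.add_re]
  congr 1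
  have hne'' : z - a ≠ 0 := by rwa [← neg_sub, neg_ne_zero]
  simp only [sub_zero]
  field_simp
  ring

/-- Near the boundary, a logarithmic potential can be exchanged for its reflection at the cost of
a Poisson kernel in the normal derivative. -/
lemma fderiv_log_norm_sub_add_apply_self {a z : ℂ} (ha : a ∈ ball 0 1) (hz : z ∈ sphere 0 1)
    {r : ℂ → ℝ} (hr : DifferentiableAt ℝ r z) :
    fderiv ℝ (fun z ↦ 1 / (2 * Real.pi) * Real.log ‖a - z‖ + r z) z z =
      fderiv ℝ (fun z ↦ reflectedLog a z + r z) z z +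
        1 / (2 * Real.pi) * poissonKernel 0 a z := by
  have hne : 1 - (starRingEnd ℂ) a * z ≠ 0 :=
    one_sub_conj_mul_ne_zero ha (sphere_subset_closedBall hz)
  have hne' : a - z ≠ 0 := by
    rw [← norm_ne_zero_iff, norm_sub_eq_norm_one_sub_conj_mul a hz]
    exact norm_ne_zero_iff.2 hne
  have hd1 : DifferentiableAt ℝ (fun z ↦ 1 / (2 * Real.pi) * Real.log ‖a - z‖) z :=
    (((show AnalyticAt ℂ (fun z ↦ a - z) z by fun_prop).harmonicAt_log_norm
      hne').1.differentiableAt (by norm_num)).const_mul _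
  have hd2 : DifferentiableAt ℝ (reflectedLog a) z :=
    (harmonicOnNhd_reflectedLog a z hne).1.differentiableAt (by norm_num)
  rw [fderiv_fun_add hd1 hr, fderiv_fun_add hd2 hr, FunLike.coe_add, FunLike.coe_add,
    Pi.add_apply, Pi.add_apply, fderiv_log_norm_sub_apply_self ha hz]
  ring

/-- Green's second identity for two logarithmic potentials with harmonic remainders. -/
lemma circleAverage_radialWronskian_log_norm {a b : ℂ} (ha : a ∈ ball 0 1) (hb : b ∈ ball 0 1)
    {p q : ℂ → ℝ} {U : Set ℂ} (hU : IsOpen U) (hUb : closedBall 0 1 ⊆ U)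
    (hp : HarmonicOnNhd p (ball 0 1)) (hq : HarmonicOnNhd q (ball 0 1))
    (hp1 : ContDiffOn ℝ 1 p U) (hq1 : ContDiffOn ℝ 1 q U) :
    Real.circleAverage (radialWronskian
      (fun z ↦ 1 / (2 * Real.pi) * Real.log ‖b - z‖ + q z)
      (fun z ↦ 1 / (2 * Real.pi) * Real.log ‖a - z‖ + p z)) 0 1 =
      1 / (2 * Real.pi) * (q a - p b) := by
  set U' := U ∩ ({z | 1 - (starRingEnd ℂ) a * z ≠ 0} ∩ {z | 1 - (starRingEnd ℂ) b * z ≠ 0})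
    with hU'
  have hopen (c : ℂ) : IsOpen {z | 1 - (starRingEnd ℂ) c * z ≠ 0} :=
    isOpen_ne_fun (by fun_prop) (by fun_prop)
  have hU'o : IsOpen U' := hU.inter ((hopen a).inter (hopen b))
  have hU'b : closedBall 0 1 ⊆ U' := fun z hz ↦
    ⟨hUb hz, one_sub_conj_mul_ne_zero ha hz, one_sub_conj_mul_ne_zero hb hz⟩
  set u : ℂ → ℝ := fun z ↦ reflectedLog b z + q z with hu
  set v : ℂ → ℝ := fun z ↦ reflectedLog a z + p z with hv
  have huh : HarmonicOnNhd u (ball 0 1) := fun z hz ↦ (harmonicOnNhd_reflectedLog b z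
    (one_sub_conj_mul_ne_zero hb (ball_subset_closedBall hz))).add (hq z hz)
  have hvh : HarmonicOnNhd v (ball 0 1) := fun z hz ↦ (harmonicOnNhd_reflectedLog a z
    (one_sub_conj_mul_ne_zero ha (ball_subset_closedBall hz))).add (hp z hz)
  have hu1 : ContDiffOn ℝ 1 u U' :=
    ((contDiffOn_reflectedLog b).mono fun z hz ↦ hz.2.2).add (hq1.mono fun z hz ↦ hz.1)
  have hv1 : ContDiffOn ℝ 1 v U' :=
    ((contDiffOn_reflectedLog a).mono fun z hz ↦ hz.2.1).add (hp1.mono fun z hz ↦ hz.1)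
  have hpoisson {c : ℂ} (hc : c ∈ ball 0 1) {f : ℂ → ℝ} (hf : ContDiffOn ℝ 1 f U') :
      CircleIntegrable (poissonKernel 0 c • f) 0 1 := by
    refine ContinuousOn.circleIntegrable' ?_
    rw [poissonKernel_eq_re_herglotzRieszKernel]
    refine (Complex.continuous_re.comp_continuousOn
      (continuousOn_herglotzRieszKernel_sphere hc)).smul (hf.continuousOn.mono ?_)
    rw [abs_one]
    exact sphere_subset_closedBall.trans hU'b
  have havg {c : ℂ} (hc : c ∈ ball 0 1) {f : ℂ → ℝ} (hf : ContDiffOn ℝ 1 f U')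
      (hfh : HarmonicOnNhd f (ball 0 1)) :
      Real.circleAverage (poissonKernel 0 c • f) 0 1 = f c :=
    (HarmonicContOnCl.mk_ball hfh (hf.continuousOn.mono hU'b)).circleAverage_poissonKernel_smul hc
  have hW : CircleIntegrable (radialWronskian u v) 0 1 := by
    refine ContinuousOn.circleIntegrable' ((continuousOn_radialWronskian hU'o hu1 hv1).mono ?_)
    rw [abs_one]
    exact sphere_subset_closedBall.trans hU'b
  have hsphere : Set.EqOn (radialWronskian
      (fun z ↦ 1 / (2 * Real.pi) * Real.log ‖b - z‖ + q z)
      (fun z ↦ 1 / (2 * Real.pi) * Real.log ‖a - z‖ + p z))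
      (radialWronskian u v + (1 / (2 * Real.pi)) •
        (poissonKernel 0 a • u - poissonKernel 0 b • v)) (sphere 0 |1|) := by
    intro z hz
    rw [abs_one] at hz
    have hzU := hUb (sphere_subset_closedBall hz)
    have hdp := (hp1.contDiffAt (hU.mem_nhds hzU)).differentiableAt one_ne_zero
    have hdq := (hq1.contDiffAt (hU.mem_nhds hzU)).differentiableAt one_ne_zero
    simp only [radialWronskian, Pi.add_apply, Pi.smul_apply, Pi.sub_apply, Pi.mul_apply,
      smul_eq_mul]
    rw [fderiv_log_norm_sub_add_apply_self ha hz hdp, fderiv_log_norm_sub_add_apply_self hb hz hdq,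
      norm_sub_eq_norm_one_sub_conj_mul a hz, norm_sub_eq_norm_one_sub_conj_mul b hz]
    simp only [hu, hv, reflectedLog]
    ring
  rw [Real.circleAverage_congr_sphere hsphere, Real.circleAverage_add hW
    (((hpoisson ha hu1).sub (hpoisson hb hv1)).const_smul), Real.circleAverage_smul,
    Real.circleAverage_sub (hpoisson ha hu1) (hpoisson hb hv1), havg ha hu1 huh, havg hb hv1 hvh,
    circleAverage_radialWronskian huh hvh hU'o hU'b hu1 hv1, hu, hv]
  simp only [reflectedLog_comm b a, smul_eq_mul]
  ring

end

/-- Exact representation of the difference between the perturbed and unperturbed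
Steklov–Neumann Green's functions of the unit disk: with `S_M` the Green's function for
the perturbed partition `(Γ_S \ Γ_Δ, (S¹ \ Γ_S) ∪ Γ_Δ)` at pole `x_S` and `S_y` the
Green's function for the unperturbed partition `(Γ_S, S¹ \ Γ_S)` at pole `y`, both with
Steklov parameter `λ`, one has `S_M(y) - S_y(x_S) = λ ∫_{Γ_Δ} S_y S_M dσ`,
where `σ = μH[1]` is the one-dimensional Hausdorff measure. -/
theorem green_function_difference_representation
    (ΓS ΓΔ : Set (EuclideanSpace ℝ (Fin 2)))
    (hΓSm : MeasurableSet ΓS) (hΓS : ΓS ⊆ sphere (0 : EuclideanSpace ℝ (Fin 2)) 1)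
    (hΓΔm : MeasurableSet ΓΔ) (hΓΔ : ΓΔ ⊆ ΓS)
    (lam : ℝ) (xS y : EuclideanSpace ℝ (Fin 2))
    (hxS : xS ∈ ball (0 : EuclideanSpace ℝ (Fin 2)) 1)
    (hy : y ∈ ball (0 : EuclideanSpace ℝ (Fin 2)) 1) (hxy : xS ≠ y)
    (RM Ry : EuclideanSpace ℝ (Fin 2) → ℝ)
    (V : Set (EuclideanSpace ℝ (Fin 2))) (hV : IsOpen V)
    (hVball : closedBall (0 : EuclideanSpace ℝ (Fin 2)) 1 ⊆ V)
    (hRMC1 : ContDiffOn ℝ 1 RM V) (hRyC1 : ContDiffOn ℝ 1 Ry V)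
    (hRMharm : IsHarmonicOn RM (ball (0 : EuclideanSpace ℝ (Fin 2)) 1))
    (hRyharm : IsHarmonicOn Ry (ball (0 : EuclideanSpace ℝ (Fin 2)) 1))
    (SM Sy : EuclideanSpace ℝ (Fin 2) → ℝ)
    (hSM : ∀ z, SM z = (1 / (2 * Real.pi)) * Real.log ‖xS - z‖ + RM z)
    (hSy : ∀ z, Sy z = (1 / (2 * Real.pi)) * Real.log ‖y - z‖ + Ry z)
    (hSMbcS : ∀ p ∈ ΓS \ ΓΔ, fderiv ℝ SM p p = lam * SM p)
    (hSMbcN : ∀ p ∈ (sphere (0 : EuclideanSpace ℝ (Fin 2)) 1 \ ΓS) ∪ ΓΔ,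
      fderiv ℝ SM p p = 0)
    (hSybcS : ∀ p ∈ ΓS, fderiv ℝ Sy p p = lam * Sy p)
    (hSybcN : ∀ p ∈ sphere (0 : EuclideanSpace ℝ (Fin 2)) 1 \ ΓS, fderiv ℝ Sy p p = 0) :
    SM y - Sy xS = lam * ∫ p in ΓΔ, Sy p * SM p ∂(μH[1]) := by
  set e := Complex.orthonormalBasisOneI.repr
  have hball : e ⁻¹' ball 0 1 = ball 0 1 := by
    rw [e.preimage_ball, map_zero]
  have hclosedBall : e ⁻¹' closedBall 0 1 = closedBall 0 1 := by
    rw [e.preimage_closedBall, map_zero]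
  have hsphere : e ⁻¹' sphere 0 1 = sphere 0 1 := by
    rw [e.preimage_sphere, map_zero]
  have hpot (x : EuclideanSpace ℝ (Fin 2)) (R S : EuclideanSpace ℝ (Fin 2) → ℝ)
      (hS : ∀ z, S z = (1 / (2 * Real.pi)) * Real.log ‖x - z‖ + R z) :
      S ∘ e = fun z ↦ 1 / (2 * Real.pi) * Real.log ‖e.symm x - z‖ + (R ∘ e) z := by
    ext z
    rw [Function.comp_apply, hS, Function.comp_apply, ← e.norm_map (e.symm x - z), map_sub,
      e.apply_symm_apply]
  have hmem {x : EuclideanSpace ℝ (Fin 2)} (hx : x ∈ ball 0 1) : e.symm x ∈ ball (0 : ℂ) 1 := by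
    rwa [← hball, Set.mem_preimage, e.apply_symm_apply]
  have hharm {R : EuclideanSpace ℝ (Fin 2) → ℝ} (hR : IsHarmonicOn R (ball 0 1)) :
      InnerProductSpace.HarmonicOnNhd (R ∘ e) (ball 0 1) := by
    rw [← hball]
    exact hR.harmonicOnNhd_comp isOpen_ball
  have hC1 {R : EuclideanSpace ℝ (Fin 2) → ℝ} (hR : ContDiffOn ℝ 1 R V) :
      ContDiffOn ℝ 1 (R ∘ e) (e ⁻¹' V) :=
    hR.comp e.contDiff.contDiffOn (Set.mapsTo_preimage e V)
  have hVe : closedBall 0 1 ⊆ e ⁻¹' V := by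
    rw [← hclosedBall]
    exact Set.preimage_mono hVball
  have hgreen := circleAverage_radialWronskian_log_norm (hmem hxS) (hmem hy)
    (hV.preimage e.continuous) hVe (hharm hRMharm) (hharm hRyharm) (hC1 hRMC1) (hC1 hRyC1)
  rw [← hpot xS RM SM hSM, ← hpot y Ry Sy hSy, Function.comp_apply, Function.comp_apply,
    e.apply_symm_apply, e.apply_symm_apply] at hgreen
  have hfderiv (S : EuclideanSpace ℝ (Fin 2) → ℝ) (z : ℂ) :
      fderiv ℝ (S ∘ e) z z = fderiv ℝ S (e z) (e z) :=
    congrArg (fun L : ℂ →L[ℝ] ℝ ↦ L z)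
      (e.toContinuousLinearEquiv.comp_right_fderiv (f := S) (x := z))
  have hbc : Set.EqOn (radialWronskian (Sy ∘ e) (SM ∘ e))
      ((-lam) • (e ⁻¹' ΓΔ).indicator fun z ↦ Sy (e z) * SM (e z)) (sphere 0 |1|) := by
    intro z hz
    rw [abs_one, ← hsphere, Set.mem_preimage] at hz
    rw [radialWronskian, hfderiv, hfderiv, Pi.smul_apply, Function.comp_apply,
      Function.comp_apply, smul_eq_mul]
    by_cases hΔ : e z ∈ ΓΔ
    · rw [hSMbcN _ (Or.inr hΔ), hSybcS _ (hΓΔ hΔ), Set.indicator_of_mem (by exact hΔ)]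
      ring
    rw [Set.indicator_of_notMem (by exact hΔ)]
    by_cases hzS : e z ∈ ΓS
    · rw [hSMbcS _ ⟨hzS, hΔ⟩, hSybcS _ hzS]
      ring
    · rw [hSMbcN _ (Or.inl ⟨hz, hzS⟩), hSybcN _ ⟨hz, hzS⟩]
      ring
  have hcont (x : EuclideanSpace ℝ (Fin 2)) (hx : x ∈ ball 0 1)
      (R S : EuclideanSpace ℝ (Fin 2) → ℝ) (hR : ContDiffOn ℝ 1 R V)
      (hS : ∀ z, S z = (1 / (2 * Real.pi)) * Real.log ‖x - z‖ + R z) :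
      ContinuousOn (S ∘ e) (sphere 0 1) := by
    rw [hpot x R S hS]
    refine ((ContinuousOn.log (by fun_prop) fun z hz ↦ ?_).const_mul _).add
      ((hC1 hR).continuousOn.mono (sphere_subset_closedBall.trans hVe))
    rw [norm_sub_eq_norm_one_sub_conj_mul _ hz]
    exact norm_ne_zero_iff.2
      (one_sub_conj_mul_ne_zero (hmem hx) (sphere_subset_closedBall hz))
  have hint : ∫ p in ΓΔ, Sy p * SM p ∂(μH[1]) = ∫ θ in (0 : ℝ)..2 * Real.pi,
      (e ⁻¹' ΓΔ).indicator (fun z ↦ Sy (e z) * SM (e z)) (circleMap 0 1 θ) := by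
    rw [← setIntegral_hausdorffMeasure_eq_intervalIntegral (F := fun z ↦ Sy (e z) * SM (e z))
      ((hcont y hy Ry Sy hRyC1 hSy).mul (hcont xS hxS RM SM hRMC1 hSM))
      (e.continuous.measurable hΓΔm) (by
        rw [← hsphere]
        exact Set.preimage_mono (hΓΔ.trans hΓS))]
    exact ((e.toIsometryEquiv.measurePreserving_hausdorffMeasure 1).setIntegral_preimage_emb
      e.toHomeomorph.measurableEmbedding (fun p ↦ Sy p * SM p) ΓΔ).symm
  rw [Real.circleAverage_congr_sphere hbc, Real.circleAverage_smul, Real.circleAverage_def, ← hint,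
    smul_eq_mul, smul_eq_mul] at hgreen
  rw [hSM, hSy, norm_sub_rev xS y]
  field_simp at hgreen
  linarith
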